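/- Let N ⊴ G be finite groups with N ≅ A₅, and suppose the elements of N \ {1} fall into exactly three G-conjugacy classes. Then G/C_G(N) ≅ S₅ (and in particular G ≠ N·C_G(N)). -/

import Mathlib

/-- The `G`-conjugacy class of `x`. -/
def gClass {G : Type*} [Group G] (x : G) : Set G := {y | ∃ g : G, y = g * x * g⁻¹}

open Equiv

/-- Pairwise non-conjugate nontrivial elements of `A₅`: a double transposition, a three-cycle, and
a five-cycle together with its square. -/
def alternatingFiveReps : Fin 4 → alternatingGroup (Fin 5) :=
  ![⟨swap 0 1 * swap 2 3, Perm.mem_alternatingGroup.mpr (by decide)⟩,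
    ⟨swap 0 1 * swap 1 2, Perm.mem_alternatingGroup.mpr (by decide)⟩,
    ⟨finRotate 5, Perm.mem_alternatingGroup.mpr (by decide)⟩,
    ⟨finRotate 5 ^ 2, Perm.mem_alternatingGroup.mpr (by decide)⟩]

theorem alternatingFiveReps_ne_one (i : Fin 4) : alternatingFiveReps i ≠ 1 := by
  revert i; decide

set_option maxRecDepth 10000 in
theorem alternatingFiveReps_not_conj :
    ∀ i j : Fin 4, i ≠ j → ∀ g : alternatingGroup (Fin 5),
      g * alternatingFiveReps i ≠ alternatingFiveReps j * g := by
  decide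

/-- The Klein four-subgroup of `A₅` fixing the last point. -/
def kleinFourFixingLast : Subgroup (alternatingGroup (Fin 5)) where
  carrier := {g | (g : Perm (Fin 5)) = 1 ∨ (g : Perm (Fin 5)) = swap 0 1 * swap 2 3 ∨
    (g : Perm (Fin 5)) = swap 0 2 * swap 1 3 ∨ (g : Perm (Fin 5)) = swap 0 3 * swap 1 2}
  one_mem' := Or.inl rfl
  mul_mem' := by
    rintro ⟨a, _⟩ ⟨b, _⟩ ha hb
    simp only [Set.mem_ofPred_eq] at ha hb
    rcases ha with rfl | rfl | rfl | rfl <;> rcases hb with rfl | rfl | rfl | rfl <;>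
      simp only [Set.mem_ofPred_eq, Subgroup.coe_mul] <;> decide
  inv_mem' := by
    rintro ⟨a, _⟩ ha
    simp only [Set.mem_ofPred_eq] at ha
    rcases ha with rfl | rfl | rfl | rfl <;>
      simp only [Set.mem_ofPred_eq, Subgroup.coe_inv] <;> decide

instance : DecidablePred (· ∈ kleinFourFixingLast) := fun g =>
  inferInstanceAs (Decidable ((g : Perm (Fin 5)) = 1 ∨ (g : Perm (Fin 5)) = swap 0 1 * swap 2 3 ∨
    (g : Perm (Fin 5)) = swap 0 2 * swap 1 3 ∨ (g : Perm (Fin 5)) = swap 0 3 * swap 1 2))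

set_option maxRecDepth 10000 in
theorem card_kleinFourFixingLast : Nat.card kleinFourFixingLast = 4 := by
  rw [Nat.card_eq_fintype_card, Fintype.card_subtype]
  decide

theorem nat_card_alternatingGroup_five : Nat.card (alternatingGroup (Fin 5)) = 60 := by
  rw [nat_card_alternatingGroup, Nat.card_eq_fintype_card, Fintype.card_fin]
  rfl

set_option maxRecDepth 10000 in
theorem threeCycle_mem_normalizer_kleinFourFixingLast :
    alternatingFiveReps 1 ∈ Subgroup.normalizer (kleinFourFixingLast : Set _) := by
  rw [Subgroup.mem_normalizer_iff]
  decide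

theorem card_sylow_two_alternatingGroup_five :
    Nat.card (Sylow 2 (alternatingGroup (Fin 5))) = 5 := by
  have hfac : (60 : ℕ).factorization 2 = 2 := by
    rw [show (60 : ℕ) = 2 ^ 2 * 15 by norm_num, Nat.factorization_mul (by norm_num) (by norm_num),
      Nat.prime_two.factorization_pow]
    simp [Nat.factorization_eq_zero_of_not_dvd]
  let P : Sylow 2 (alternatingGroup (Fin 5)) := Sylow.ofCard kleinFourFixingLast (by
    rw [card_kleinFourFixingLast, nat_card_alternatingGroup_five, hfac]; norm_num)
  have hP : (P : Set (alternatingGroup (Fin 5))) = kleinFourFixingLast := rfl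
  rw [P.card_eq_index_normalizer, hP]
  set H := Subgroup.normalizer (kleinFourFixingLast : Set (alternatingGroup (Fin 5))) with hH
  have h4 : 4 ∣ Nat.card H :=
    card_kleinFourFixingLast ▸ Subgroup.card_dvd_of_le Subgroup.le_normalizer
  have h3 : 3 ∣ Nat.card H := by
    have : orderOf (alternatingFiveReps 1) = 3 := orderOf_eq_prime (by decide) (by decide)
    exact this ▸ Subgroup.orderOf_dvd_natCard H threeCycle_mem_normalizer_kleinFourFixingLast
  have hmul := H.card_mul_index
  rw [nat_card_alternatingGroup_five] at hmul
  have hne : H.index ≠ 1 := by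
    intro h
    have hn : kleinFourFixingLast.Normal :=
      Subgroup.normalizer_eq_top_iff.mp (Subgroup.index_eq_one.mp h)
    have hc := card_kleinFourFixingLast
    rcases hn.eq_bot_or_eq_top with h | h <;> rw [h] at hc
    · simp at hc
    · rw [Subgroup.card_top, nat_card_alternatingGroup_five] at hc
      omega
  obtain ⟨k, hk⟩ : 12 ∣ Nat.card H := Nat.Coprime.mul_dvd_of_dvd_of_dvd (by norm_num) h4 h3
  rw [hk] at hmul
  have h5 : H.index ∣ 5 := ⟨k, by linarith⟩
  exact ((Nat.dvd_prime Nat.prime_five).mp h5).resolve_left hne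

theorem card_sylow_le_of_mulEquiv {H K : Type*} [Group H] [Group K] [Finite K] (p : ℕ)
    (e : K ≃* H) : Nat.card (Sylow p H) ≤ Nat.card (Sylow p K) := by
  refine Nat.card_le_card_of_injective
    (fun P : Sylow p H => P.comapOfInjective e.toMonoidHom e.injective
      (by rw [MonoidHom.range_eq_top.mpr e.surjective]; exact le_top)) fun P Q h => ?_
  exact Sylow.ext (Subgroup.comap_injective (f := e.toMonoidHom) e.surjective
    (congrArg Sylow.toSubgroup h))

/-- The conjugation action of `G` on the Sylow `p`-subgroups of a normal subgroup. -/
def conjSylowHom {G : Type*} [Group G] (p : ℕ) (N : Subgroup G) [N.Normal] :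
    G →* Perm (Sylow p N) :=
  (MulAction.toPermHom (MulAut N) (Sylow p N)).comp MulAut.conjNormal

theorem conjSylowHom_coe {G : Type*} [Group G] (p : ℕ) (N : Subgroup G) [N.Normal] (n : N)
    (P : Sylow p N) : conjSylowHom p N (n : G) P = n • P := by
  have : (MulAut.conjNormal (n : G) : MulAut N) = MulAut.conj n := by
    ext m; simp
  rw [Sylow.smul_def, ← this]
  rfl

theorem centralizer_le_ker_conjSylowHom {G : Type*} [Group G] (p : ℕ) (N : Subgroup G)
    [N.Normal] : Subgroup.centralizer (N : Set G) ≤ (conjSylowHom p N).ker := by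
  intro g hg
  have : (MulAut.conjNormal g : MulAut N) = 1 := by
    ext m
    simp [MulAut.conjNormal_apply, ← Subgroup.mem_centralizer_iff.mp hg m m.2]
  rw [MonoidHom.mem_ker, conjSylowHom, MonoidHom.comp_apply, this, map_one]

theorem disjoint_ker_conjSylowHom {G : Type*} [Group G] (p : ℕ) [Fact p.Prime] (N : Subgroup G)
    [N.Normal] [Finite N] [IsSimpleGroup N] (h : 1 < Nat.card (Sylow p N)) :
    Disjoint (conjSylowHom p N).ker N := by
  have hn : ((conjSylowHom p N).ker.subgroupOf N).Normal := inferInstance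
  rw [← Subgroup.subgroupOf_eq_bot]
  refine hn.eq_bot_or_eq_top.resolve_right fun htop => ?_
  have : Subsingleton (Sylow p N) := ⟨fun P Q => by
    obtain ⟨n, rfl⟩ := MulAction.exists_smul_eq N P Q
    have hmem : n ∈ (conjSylowHom p N).ker.subgroupOf N := htop ▸ Subgroup.mem_top n
    rw [Subgroup.mem_subgroupOf, MonoidHom.mem_ker] at hmem
    rw [← conjSylowHom_coe, hmem, Perm.one_apply]⟩
  exact h.not_ge (Finite.card_le_one_iff_subsingleton.mpr this)

theorem ker_conjSylowHom {G : Type*} [Group G] (p : ℕ) [Fact p.Prime] (N : Subgroup G)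
    [N.Normal] [Finite N] [IsSimpleGroup N] (h : 1 < Nat.card (Sylow p N)) :
    (conjSylowHom p N).ker = Subgroup.centralizer (N : Set G) := by
  refine le_antisymm (fun g hg => Subgroup.mem_centralizer_iff.mpr fun n hn => ?_)
    (centralizer_le_ker_conjSylowHom p N)
  exact (Subgroup.commute_of_normal_of_disjoint _ _ inferInstance inferInstance
    (disjoint_ker_conjSylowHom p N h) g n hg hn).eq.symm

/-- If `G = N C_G(N)`, then conjugacy in `G` between elements of `N` is conjugacy in `N`. -/
theorem isConj_of_sup_centralizer_eq_top {G : Type*} [Group G] {N : Subgroup G} [N.Normal]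
    (h : N ⊔ Subgroup.centralizer (N : Set G) = ⊤) {a b : N} (hab : IsConj (a : G) b) :
    IsConj a b := by
  obtain ⟨g, hg⟩ := isConj_iff.mp hab
  obtain ⟨n, hn, c, hc, rfl⟩ := Subgroup.mem_sup_of_normal_left.mp (h.symm ▸ Subgroup.mem_top g :
    g ∈ N ⊔ Subgroup.centralizer (N : Set G))
  refine isConj_iff.mpr ⟨⟨n, hn⟩, Subtype.ext ?_⟩
  have hca := Subgroup.mem_centralizer_iff.mp hc a a.2
  rw [← hg]
  simp only [Subgroup.coe_mul, Subgroup.coe_inv]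
  rw [mul_assoc n c, ← hca]
  group

theorem mem_gClass_iff {G : Type*} [Group G] {x y : G} : y ∈ gClass x ↔ IsConj x y := by
  simp [gClass, isConj_iff, eq_comm]

theorem sup_centralizer_ne_top {G : Type*} [Group G] (N : Subgroup G) [N.Normal]
    (e : N ≃* alternatingGroup (Fin 5)) (x y z : G)
    (hall : ∀ w ∈ N, w ≠ 1 → w ∈ gClass x ∪ gClass y ∪ gClass z) :
    N ⊔ Subgroup.centralizer (N : Set G) ≠ ⊤ := by
  intro htop
  let w : Fin 4 → N := fun i => e.symm (alternatingFiveReps i)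
  have hcl : ∀ i, ∃ k : Fin 3, IsConj (![x, y, z] k) (w i : G) := by
    intro i
    have h1 : (w i : G) ≠ 1 := by
      simpa [w] using alternatingFiveReps_ne_one i
    rcases hall _ (w i).2 h1 with (h | h) | h
    · exact ⟨0, mem_gClass_iff.mp h⟩
    · exact ⟨1, mem_gClass_iff.mp h⟩
    · exact ⟨2, mem_gClass_iff.mp h⟩
  choose k hk using hcl
  obtain ⟨i, j, hij, hkij⟩ := Fintype.exists_ne_map_eq_of_card_lt k (by simp)
  have hconj := isConj_of_sup_centralizer_eq_top htop ((hk i).symm.trans (hkij ▸ hk j))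
  obtain ⟨g, hg⟩ := isConj_iff.mp (e.toMonoidHom.map_isConj hconj)
  refine alternatingFiveReps_not_conj i j hij g ?_
  simpa [w, mul_inv_eq_iff_eq_mul] using hg

/-- If `N ⊴ G` with `N ≅ A₅` and `N \ {1}` consists of exactly three `G`-conjugacy classes,
then `G/C_G(N) ≅ S₅`; in particular `G ≠ N ⬝ C_G(N)`. -/
theorem stmt_19 {G : Type*} [Group G] [Fintype G] (N : Subgroup G) [N.Normal]
    (hA5 : Nonempty (↥N ≃* alternatingGroup (Fin 5)))
    (x y z : G) (hxN : x ∈ N) (hyN : y ∈ N) (hzN : z ∈ N)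
    (hx1 : x ≠ 1) (hy1 : y ≠ 1) (hz1 : z ≠ 1)
    (hxy : gClass x ≠ gClass y) (hxz : gClass x ≠ gClass z) (hyz : gClass y ≠ gClass z)
    (hall : ∀ w ∈ N, w ≠ 1 → w ∈ gClass x ∪ gClass y ∪ gClass z) :
    (∃ φ : G →* Equiv.Perm (Fin 5), Function.Surjective φ ∧
        φ.ker = Subgroup.centralizer (N : Set G)) ∧
      N ⊔ Subgroup.centralizer (N : Set G) ≠ ⊤ := by
  obtain ⟨e⟩ := hA5
  have hne := sup_centralizer_ne_top N e x y z hall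
  refine ⟨?_, hne⟩
  have : IsSimpleGroup N := e.isSimpleGroup
  have hS : Nat.card (Sylow 2 N) = 5 := card_sylow_two_alternatingGroup_five ▸
    le_antisymm (card_sylow_le_of_mulEquiv 2 e.symm) (card_sylow_le_of_mulEquiv 2 e)
  have hker := ker_conjSylowHom 2 N (by omega)
  have hdisj := disjoint_ker_conjSylowHom 2 N (by omega)
  set φ := conjSylowHom 2 N
  have hcard : Nat.card (N.map φ) = 60 := by
    rw [← nat_card_alternatingGroup_five, ← Nat.card_congr e.toEquiv]
    have hinj : Function.Injective (φ.domRestrict N) := by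
      rw [← MonoidHom.ker_eq_bot_iff, MonoidHom.ker_domRestrict, Subgroup.subgroupOf_eq_bot]
      exact hdisj
    rw [← MonoidHom.domRestrict_range]
    exact (Nat.card_congr (MonoidHom.ofInjective hinj).toEquiv).symm
  have hPerm : Nat.card (Perm (Sylow 2 N)) = 120 := by
    rw [Nat.card_perm, hS]; rfl
  have hsurj : Function.Surjective φ := by
    rw [← MonoidHom.range_eq_top, ← Subgroup.index_eq_one]
    have hle : N.map φ ≤ φ.range := Subgroup.map_le_range φ N
    obtain ⟨k, hk⟩ := hcard ▸ Subgroup.card_dvd_of_le hle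
    have hmul := φ.range.card_mul_index
    rw [hPerm, hk] at hmul
    have h2 : φ.range.index ∣ 2 := ⟨k, by linarith⟩
    refine ((Nat.dvd_prime Nat.prime_two).mp h2).resolve_right fun hi => hne ?_
    have heq : N.map φ = φ.range := Subgroup.eq_of_le_of_card_ge hle (by
      rw [hi] at hmul; omega)
    rw [← hker]
    exact codisjoint_iff.mp (Subgroup.map_eq_range_iff.mp heq)
  let f : Sylow 2 N ≃ Fin 5 := Finite.equivFinOfCardEq hS
  refine ⟨f.permCongrHom.toMonoidHom.comp φ, f.permCongrHom.surjective.comp hsurj, ?_⟩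
  rw [← hker]
  exact MonoidHom.ker_comp_of_injective φ _ f.permCongrHom.injective
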